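/- arXiv:1903.00501 — 2 statements merged into one kernel-verified Lean document; each statement's English description precedes it below -/
import Mathlib

section
/- Let n be a positive integer and let F be a permutation of GF(2^n). Then for any nonzero a in GF(2^n), Σ_{c ∈ GF(2^n)} BCT_F(a,c) = Σ_{c ∈ GF(2^n)} DDT_F(a,c)^2 (sums taken over all c, including c = 0). -/
open scoped Classical

/-- Difference Distribution Table entry: `DDT F a b = #{x | F(x+a) + F(x) = b}`. -/
noncomputable def DDT {K : Type*} [Field K] (F : K → K) (a b : K) : ℕ :=
  Set.ncard {x : K | F (x + a) + F x = b}

/-- Boomerang Connectivity Table entry: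
`BCT F a b = #{x | F⁻¹(F(x)+b) + F⁻¹(F(x+a)+b) = a}`, where `F⁻¹` is the compositional
inverse of the permutation `F` (realized via `Function.invFun`). -/
noncomputable def BCT {K : Type*} [Field K] (F : K → K) (a b : K) : ℕ :=
  haveI : Nonempty K := ⟨0⟩
  Set.ncard {x : K |
    Function.invFun F (F x + b) + Function.invFun F (F (x + a) + b) = a}

/-- Differential uniformity: the maximum of `DDT F a b` over nonzero `a, b`. -/
noncomputable def deltaU {K : Type*} [Field K] [Fintype K] (F : K → K) : ℕ :=
  Finset.sup (Finset.univ.filter fun p : K × K => p.1 ≠ 0 ∧ p.2 ≠ 0)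
    fun p => DDT F p.1 p.2

/-- Boomerang uniformity: the maximum of `BCT F a b` over nonzero `a, b`. -/
noncomputable def betaU {K : Type*} [Field K] [Fintype K] (F : K → K) : ℕ :=
  Finset.sup (Finset.univ.filter fun p : K × K => p.1 ≠ 0 ∧ p.2 ≠ 0)
    fun p => BCT F p.1 p.2

theorem charTwo_of_card_eq_two_pow {K : Type*} [Field K] [Fintype K] {n : ℕ}
    (hcard : Fintype.card K = 2 ^ n) : CharP K 2 := by
  have h : (2 : K) = 0 := by
    have h := FiniteField.cast_card_eq_zero K
    rw [hcard] at h
    push_cast at h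
    exact eq_zero_of_pow_eq_zero h
  exact CharTwo.of_one_ne_zero_of_two_eq_zero one_ne_zero h

theorem DDT_eq_sum {K : Type*} [Field K] [Fintype K] (F : K → K) (a b : K) :
    DDT F a b = ∑ x : K, if F (x + a) + F x = b then 1 else 0 := by
  rw [DDT, Set.ncard_eq_toFinset_card', Finset.sum_boole]
  simp

theorem BCT_eq_sum {K : Type*} [Field K] [Fintype K] (F : K → K) (a b : K) :
    BCT F a b = ∑ x : K,
      if Function.invFun F (F x + b) + Function.invFun F (F (x + a) + b) = a then 1 else 0 := by
  rw [BCT, Set.ncard_eq_toFinset_card', Finset.sum_boole]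
  simp

/-- The boomerang condition for the output difference `F y + F x` says that `x` and `y` have
the same derivative of `F` in direction `a`. -/
theorem boomerang_add_iff {K : Type*} [Field K] [CharP K 2] {F : K → K}
    (hF : Function.Bijective F) (a x y : K) :
    Function.invFun F (F x + (F y + F x)) + Function.invFun F (F (x + a) + (F y + F x)) = a ↔
      F (y + a) + F y = F (x + a) + F x := by
  have hy : F x + (F y + F x) = F y := by
    rw [add_left_comm, CharTwo.add_self_eq_zero, add_zero]
  have hinv : F (Function.invFun F (F (x + a) + (F y + F x))) = F (x + a) + (F y + F x) :=
    Function.rightInverse_invFun hF.surjective _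
  rw [hy, Function.leftInverse_invFun hF.injective y, add_comm, CharTwo.add_eq_iff_eq_add,
    add_comm a y, ← hF.injective.eq_iff, hinv, CharTwo.add_eq_iff_eq_add (a := F (y + a)),
    eq_comm, add_right_comm, add_assoc]

theorem bct_full_row_sum {K : Type*} [Field K] [Fintype K] (n : ℕ) (hn : 0 < n)
    (hcard : Fintype.card K = 2 ^ n) (F : K → K) (hF : Function.Bijective F)
    (a : K) (ha : a ≠ 0) :
    ∑ c : K, BCT F a c = ∑ c : K, (DDT F a c) ^ 2 := by
  have : CharP K 2 := charTwo_of_card_eq_two_pow hcard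
  trans ∑ x : K, ∑ y : K, if F (y + a) + F y = F (x + a) + F x then 1 else 0
  · simp_rw [BCT_eq_sum]
    rw [Finset.sum_comm]
    refine Finset.sum_congr rfl fun x _ => ?_
    rw [← ((Equiv.ofBijective F hF).trans (Equiv.addRight (F x))).sum_comp]
    refine Finset.sum_congr rfl fun y _ => ?_
    simp only [Equiv.trans_apply, Equiv.ofBijective_apply, Equiv.coe_addRight,
      boomerang_add_iff hF]
  · simp_rw [DDT_eq_sum, sq, Finset.sum_mul_sum]
    symm
    rw [Finset.sum_comm]
    refine Finset.sum_congr rfl fun x _ => ?_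
    rw [Finset.sum_comm]
    refine Finset.sum_congr rfl fun y _ => ?_
    simp [eq_comm]
end

section
/- Let q = 2^e (e ≥ 1) be a power of 2 and m a positive integer. Let F : GF(q^m) → GF(q^m) be a permutation of the form F(x) = Σ_{0 ≤ i ≤ j ≤ m−1} c_{ij} x^{q^i + q^j} with coefficients c_{ij} ∈ GF(q^m), and suppose Δ(F) = q. Then for all nonzero a, b in GF(q^m), BCT_F(a,b) = Σ_{γ ∈ GF(q), γ ≠ 0} DDT_F(aγ, b), where GF(q) is the subfield of GF(q^m) with q elements. -/
open scoped Classical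

/-- The polar form of a function. -/
def polarForm {K : Type*} [Add K] (F : K → K) (x y : K) : K := F (x + y) + F x + F y

/-- In a finite field with `q ^ m` elements, exactly `q` elements are fixed by `x ↦ x ^ q`. -/
lemma card_filter_pow_eq_self {K : Type*} [Field K] [Fintype K] (p q m : ℕ) [CharP K p]
    (hpq : p ∣ q) (hq : 1 < q) (hcard : Fintype.card K = q ^ m) :
    (Finset.univ.filter fun γ : K => γ ^ q = γ).card = q := by
  have hdvd : (Polynomial.X ^ q - Polynomial.X : Polynomial K) ∣
      Polynomial.X ^ Nat.card K - Polynomial.X := by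
    rw [Nat.card_eq_fintype_card, hcard]
    simpa using dvd_pow_pow_sub_self_of_dvd (r := (Polynomial.X : Polynomial K)) (p := q)
      (one_dvd m)
  have hne : (Polynomial.X ^ Nat.card K - Polynomial.X : Polynomial K) ≠ 0 :=
    FiniteField.X_pow_card_sub_X_ne_zero K Finite.one_lt_card
  have hne' := FiniteField.X_pow_card_sub_X_ne_zero K hq
  have hs := (Polynomial.splits_X_pow_nat_card_sub_X (K := K)).of_dvd hne hdvd
  have h := Polynomial.card_rootSet_eq_natDegree (K := K) (galois_poly_separable (K := K) p q hpq)
    (by simpa using hs)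
  rw [FiniteField.X_pow_card_sub_X_natDegree_eq K hq] at h
  rw [← Set.toFinset_card] at h
  refine Eq.trans (congrArg Finset.card ?_) h
  ext γ
  simp [Polynomial.mem_rootSet, hne', sub_eq_zero]

lemma pow_pow_eq_self {K : Type*} [Monoid K] {q : ℕ} {γ : K} (hγ : γ ^ q = γ) (i : ℕ) :
    γ ^ q ^ i = γ := by
  induction i with
  | zero => simp
  | succ i ih => rw [pow_succ, pow_mul, ih, hγ]

/-- A Dembowski–Ostrom polynomial is homogeneous of degree two over the fixed field of
`x ↦ x ^ q`. -/
lemma map_mul_of_pow_eq_self {K : Type*} [Field K] {q m : ℕ} {c : Fin m → Fin m → K} {F : K → K}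
    (hF : ∀ x : K, F x =
      ∑ ij ∈ Finset.univ.filter (fun ij : Fin m × Fin m => ij.1 ≤ ij.2),
        c ij.1 ij.2 * x ^ (q ^ (ij.1 : ℕ) + q ^ (ij.2 : ℕ)))
    {γ : K} (hγ : γ ^ q = γ) (x : K) : F (x * γ) = γ ^ 2 * F x := by
  simp only [hF, Finset.mul_sum]
  refine Finset.sum_congr rfl fun ij _ => ?_
  rw [mul_pow, pow_add γ, pow_pow_eq_self hγ, pow_pow_eq_self hγ]
  ring

section CharTwo

variable {K : Type*} [Field K] [CharP K 2]

/-- A Dembowski–Ostrom polynomial has a polar form which is additive in its first argument. -/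
lemma polarForm_add_left {e m : ℕ} {c : Fin m → Fin m → K} {F : K → K}
    (hF : ∀ x : K, F x =
      ∑ ij ∈ Finset.univ.filter (fun ij : Fin m × Fin m => ij.1 ≤ ij.2),
        c ij.1 ij.2 * x ^ ((2 ^ e) ^ (ij.1 : ℕ) + (2 ^ e) ^ (ij.2 : ℕ)))
    (x y a : K) : polarForm F (x + y) a = polarForm F x a + polarForm F y a := by
  simp only [polarForm, hF, ← Finset.sum_add_distrib]
  refine Finset.sum_congr rfl fun ij _ => ?_
  simp only [pow_add _ (_ ^ _) (_ ^ _), ← pow_mul 2 e, add_pow_char_pow]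
  linear_combination c ij.1 ij.2 * (x ^ 2 ^ (e * (ij.1 : ℕ)) * y ^ 2 ^ (e * (ij.2 : ℕ)) +
    y ^ 2 ^ (e * (ij.1 : ℕ)) * x ^ 2 ^ (e * (ij.2 : ℕ)) -
    a ^ 2 ^ (e * (ij.1 : ℕ)) * a ^ 2 ^ (e * (ij.2 : ℕ))) * CharTwo.two_eq_zero (R := K)

lemma polarForm_mul_self {q : ℕ} {F : K → K}
    (hF : ∀ γ x : K, γ ^ q = γ → F (x * γ) = γ ^ 2 * F x) {γ : K} (hγ : γ ^ q = γ)
    (hγ' : (γ + 1) ^ q = γ + 1) (a : K) : polarForm F (a * γ) a = 0 := by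
  rw [polarForm, show a * γ + a = a * (γ + 1) by ring, hF _ _ hγ, hF _ _ hγ']
  linear_combination (γ ^ 2 + γ + 1) * F a * CharTwo.two_eq_zero (R := K)

/-- If the derivative of `F` in direction `a` takes the value `F a` at most `q` times, then the
kernel of `polarForm F · a` is the line spanned by `a` over the field with `q` elements. -/
lemma polarForm_eq_zero_iff [Fintype K] {q m : ℕ} {F : K → K} (hq : 1 < q)
    (hq2 : ∃ e, q = 2 ^ e) (hcard : Fintype.card K = q ^ m)
    (hF : ∀ γ x : K, γ ^ q = γ → F (x * γ) = γ ^ 2 * F x)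
    {a : K} (ha : a ≠ 0) (hD : DDT F a (F a) ≤ q) (x : K) :
    polarForm F x a = 0 ↔ ∃ γ : K, γ ^ q = γ ∧ a * γ = x := by
  obtain ⟨e, rfl⟩ := hq2
  have he : e ≠ 0 := by rintro rfl; simp at hq
  have hset : {x : K | F (x + a) + F x = F a} = {x : K | polarForm F x a = 0} := by
    ext x
    simp [polarForm, CharTwo.add_eq_zero]
  set S := Finset.univ.filter fun γ : K => γ ^ 2 ^ e = γ
  have hS : (S.image (a * ·)).card = 2 ^ e := by
    rw [Finset.card_image_of_injective _ (mul_right_injective₀ ha)]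
    exact card_filter_pow_eq_self 2 (2 ^ e) m (dvd_pow_self 2 he) hq hcard
  have hsub : S.image (a * ·) ⊆ Finset.univ.filter fun x => polarForm F x a = 0 := by
    intro x hx
    obtain ⟨γ, hγ, rfl⟩ := Finset.mem_image.mp hx
    have hγ := (Finset.mem_filter.mp hγ).2
    simpa using polarForm_mul_self hF hγ (by rw [add_pow_char_pow, hγ, one_pow]) a
  have heq := Finset.eq_of_subset_of_card_le hsub (by
    rw [hS]
    rw [DDT, hset, Set.ncard_eq_toFinset_card'] at hD
    convert hD
    ext; simp)
  have := Finset.ext_iff.mp heq x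
  simpa [S] using this.symm

/-- The boomerang condition for a quadratic permutation, expressed without its inverse. -/
lemma boomerang_iff [Nonempty K] {F : K → K} (hbij : Function.Bijective F) {a : K}
    (hadd : ∀ x y, polarForm F (x + y) a = polarForm F x a + polarForm F y a) (b x : K) :
    Function.invFun F (F x + b) + Function.invFun F (F (x + a) + b) = a ↔
      ∃ z, polarForm F z a = 0 ∧ F (x + z) + F x = b := by
  have h2 : (2 : K) = 0 := CharTwo.two_eq_zero
  have hinv := Function.rightInverse_invFun hbij.surjective
  have hy : F (Function.invFun F (F x + b)) = F x + b := hinv _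
  have hw : F (Function.invFun F (F (x + a) + b)) = F (x + a) + b := hinv _
  generalize Function.invFun F (F x + b) = y at *
  generalize Function.invFun F (F (x + a) + b) = w at *
  have hyx : x + (x + y) = y := by linear_combination x * h2
  have hpolar := hadd x (x + y)
  simp only [hyx, polarForm] at hpolar
  constructor
  · intro h
    obtain rfl : w = y + a := by linear_combination h - y * h2
    refine ⟨x + y, ?_, by rw [hyx]; linear_combination hy + F x * h2⟩
    rw [polarForm]
    linear_combination -hpolar + hy + hw + b * h2
  · rintro ⟨z, hz, hxz⟩
    obtain rfl : x + z = y := hbij.injective (by linear_combination hxz - hy - F x * h2)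
    rw [show x + (x + z) = z by linear_combination x * h2] at hpolar
    rw [polarForm] at hz
    obtain rfl : x + z + a = w := hbij.injective (by
      linear_combination hpolar + hz - hw - hy - b * h2)
    linear_combination (x + z) * h2

end CharTwo

lemma DDT_le_deltaU {K : Type*} [Field K] [Fintype K] (F : K → K) {a b : K}
    (ha : a ≠ 0) (hb : b ≠ 0) : DDT F a b ≤ deltaU F :=
  Finset.le_sup (f := fun p : K × K => DDT F p.1 p.2) (b := (a, b)) (by simp [ha, hb])

theorem bct_as_subfield_ddt_sum {K : Type*} [Field K] [Fintype K] (e m q : ℕ)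
    (he : 1 ≤ e) (hm : 0 < m) (hq : q = 2 ^ e) (hcard : Fintype.card K = q ^ m)
    (c : Fin m → Fin m → K) (F : K → K)
    (hF : ∀ x : K, F x =
      ∑ ij ∈ Finset.univ.filter (fun ij : Fin m × Fin m => ij.1 ≤ ij.2),
        c ij.1 ij.2 * x ^ (q ^ (ij.1 : ℕ) + q ^ (ij.2 : ℕ)))
    (hbij : Function.Bijective F) (hdelta : deltaU F = q)
    (a b : K) (ha : a ≠ 0) (hb : b ≠ 0) :
    BCT F a b =
      ∑ γ ∈ Finset.univ.filter (fun γ : K => γ ^ q = γ ∧ γ ≠ 0), DDT F (a * γ) b := by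
  have hcard2 : Fintype.card K = 2 ^ (e * m) := by rw [hcard, hq, pow_mul]
  have : CharP K 2 := by
    have : Fact (Nat.Prime 2) := ⟨Nat.prime_two⟩
    exact charP_of_card_eq_prime_pow hcard2
  have : Nonempty K := ⟨0⟩
  subst hq
  have hq1 : 1 < 2 ^ e := Nat.one_lt_two_pow (by omega)
  have hhom : ∀ γ x : K, γ ^ 2 ^ e = γ → F (x * γ) = γ ^ 2 * F x :=
    fun γ x hγ => map_mul_of_pow_eq_self hF hγ x
  have hF0 : F 0 = 0 := by simpa using hhom 0 0 (zero_pow (by positivity))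
  have hFa : F a ≠ 0 := fun h => ha (hbij.injective (h.trans hF0.symm))
  have hker := polarForm_eq_zero_iff hq1 ⟨e, rfl⟩ hcard hhom ha
    ((DDT_le_deltaU F ha hFa).trans_eq hdelta)
  have hset : {x : K | Function.invFun F (F x + b) + Function.invFun F (F (x + a) + b) = a} =
      ↑((Finset.univ.filter fun γ : K => γ ^ 2 ^ e = γ ∧ γ ≠ 0).biUnion
        fun γ => Finset.univ.filter fun x => F (x + a * γ) + F x = b) := by
    ext x
    simp only [Set.mem_ofPred_eq, boomerang_iff hbij (fun x y => polarForm_add_left hF x y a),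
      Finset.coe_biUnion, Finset.mem_univ, true_and,
      Finset.coe_filter, Set.mem_iUnion, hker, exists_prop]
    constructor
    · rintro ⟨_, ⟨γ, hγ, rfl⟩, hx⟩
      refine ⟨γ, ⟨hγ, ?_⟩, hx⟩
      rintro rfl
      exact hb (by simpa [CharTwo.add_self_eq_zero] using hx.symm)
    · rintro ⟨γ, ⟨hγ, -⟩, hx⟩
      exact ⟨_, ⟨γ, hγ, rfl⟩, hx⟩
  rw [BCT, hset, Set.ncard_coe_finset, Finset.card_biUnion]
  · refine Finset.sum_congr rfl fun γ _ => ?_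
    rw [DDT, ← Set.ncard_coe_finset]
    simp
  · intro γ _ δ _ hne
    refine Finset.disjoint_left.mpr fun x hγ hδ => hne ?_
    simp only [Finset.mem_filter, Finset.mem_univ, true_and] at hγ hδ
    have h := hbij.injective (add_right_cancel (hγ.trans hδ.symm))
    exact mul_left_cancel₀ ha (add_left_cancel h)
end
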